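/- arXiv:2404.18164 — 4 statements merged into one kernel-verified Lean document; each statement's English description precedes it below -/
import Mathlib

section
/- For all x, v ∈ ℝ^d one has 2·ε₀·r_l(x, v) ≤ r_s(x, v), where ε₀ = (1/2)·min{1, 2αγ/(3√L_K), α}. -/
/-- Comparison of a quadratic form in two nonnegative reals with the square of a linear form. -/
lemma sq_mul_quadratic_le_sq_add {m α Λ τ a b : ℝ} (hm : 0 ≤ m) (hm1 : m ≤ 1) (hmα : m ≤ α)
    (hΛ : 9 * (m ^ 2 * Λ) ≤ 4 * α ^ 2) (hτ : 0 ≤ τ) (hτ8 : τ ≤ 1 / 8)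
    (ha : 0 ≤ a) (hb : 0 ≤ b) :
    m ^ 2 * (Λ * a ^ 2 + (1 / 2) * (a + b) ^ 2 + (1 / 2) * (b + 2 * τ * a) ^ 2)
      ≤ (α * a + b) ^ 2 := by
  have hsq_one : m ^ 2 ≤ 1 := by nlinarith
  have hsq_α : m ^ 2 ≤ α := by nlinarith
  have hsq_sq : m ^ 2 ≤ α ^ 2 := by nlinarith
  have hτ_sq : τ ^ 2 ≤ 1 / 64 := by nlinarith
  have hbb : m ^ 2 * b ^ 2 ≤ 1 * b ^ 2 := by gcongr
  have hab : m ^ 2 * (1 + 2 * τ) ≤ 2 * α := by nlinarith [sq_nonneg m]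
  have haa : m ^ 2 * (Λ + 1 / 2 + 2 * τ ^ 2) ≤ α ^ 2 := by nlinarith [sq_nonneg m]
  have hab' := mul_le_mul_of_nonneg_right hab (mul_nonneg ha hb)
  have haa' := mul_le_mul_of_nonneg_right haa (sq_nonneg a)
  linarith

/-- `2·ε₀·r_l(x,v) ≤ r_s(x,v)` with
`ε₀ = (1/2)·min{1, 2αγ/(3√L_K), α}`. -/
theorem two_eps_rl_le_rs
    (d : ℕ) (hd : 1 ≤ d) (γ κ L_K L_g τ α ε₀ : ℝ)
    (hγ : 0 < γ) (hκ : 0 < κ) (hLK : κ ≤ L_K) (hLg : 0 ≤ L_g)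
    (hLgsmall : L_g < γ * Real.sqrt (κ / 2))
    (hτ : τ = min (1 / 8) (κ / (2 * γ ^ 2) - L_g ^ 2 / γ ^ 4))
    (hα : α = 2 * (L_K + L_g) / γ ^ 2)
    (hε₀ : ε₀ = (1 / 2) * min 1 (min (2 * α * γ / (3 * Real.sqrt L_K)) α))
    (K : EuclideanSpace ℝ (Fin d) →ₗ[ℝ] EuclideanSpace ℝ (Fin d))
    (hKsymm : ∀ x y : EuclideanSpace ℝ (Fin d), (inner ℝ (K x) y : ℝ) = inner ℝ x (K y))
    (hKlb : ∀ x : EuclideanSpace ℝ (Fin d), κ * ‖x‖ ^ 2 ≤ (inner ℝ (K x) x : ℝ))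
    (hKub : ∀ x : EuclideanSpace ℝ (Fin d), (inner ℝ (K x) x : ℝ) ≤ L_K * ‖x‖ ^ 2)
    (x v : EuclideanSpace ℝ (Fin d)) :
    2 * ε₀ * Real.sqrt ((inner ℝ (K x) x : ℝ) / γ ^ 2 + (1 / 2) * ‖v‖ ^ 2 / γ ^ 2
        + (1 / 2) * ‖(1 - 2 * τ) • x + γ⁻¹ • v‖ ^ 2)
      ≤ α * ‖x‖ + ‖x + γ⁻¹ • v‖ := by
  have hLK0 : 0 < L_K := hκ.trans_le hLK
  have hα0 : 0 < α := by rw [hα]; positivity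
  have hs0 : 0 < Real.sqrt L_K := Real.sqrt_pos.2 hLK0
  have hτ8 : τ ≤ 1 / 8 := hτ ▸ min_le_left _ _
  have hτ0 : 0 ≤ τ := by
    have hLg_sq : L_g ^ 2 ≤ γ ^ 2 * (κ / 2) := by
      calc L_g ^ 2 ≤ (γ * Real.sqrt (κ / 2)) ^ 2 := by gcongr
        _ = γ ^ 2 * (κ / 2) := by rw [mul_pow, Real.sq_sqrt (by positivity)]
    have hdiv : L_g ^ 2 / γ ^ 4 ≤ κ / (2 * γ ^ 2) := by
      calc L_g ^ 2 / γ ^ 4 ≤ γ ^ 2 * (κ / 2) / γ ^ 4 := by gcongr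
        _ = κ / (2 * γ ^ 2) := by field_simp
    rw [hτ]
    exact le_min (by norm_num) (sub_nonneg.2 hdiv)
  obtain ⟨m, hm⟩ : ∃ m, m = min 1 (min (2 * α * γ / (3 * Real.sqrt L_K)) α) := ⟨_, rfl⟩
  have hεm : 2 * ε₀ = m := by rw [hε₀, ← hm]; ring
  have hm0 : 0 ≤ m := by rw [hm]; positivity
  have hm1 : m ≤ 1 := hm ▸ min_le_left _ _
  have hmα : m ≤ α := hm ▸ (min_le_right _ _).trans (min_le_right _ _)
  have hmΛ : 9 * (m ^ 2 * (L_K / γ ^ 2)) ≤ 4 * α ^ 2 := by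
    have hms : m ≤ 2 * α * γ / (3 * Real.sqrt L_K) :=
      hm ▸ (min_le_right _ _).trans (min_le_left _ _)
    calc 9 * (m ^ 2 * (L_K / γ ^ 2))
        ≤ 9 * ((2 * α * γ / (3 * Real.sqrt L_K)) ^ 2 * (L_K / γ ^ 2)) := by gcongr
      _ = 4 * α ^ 2 := by
        rw [div_pow, mul_pow 3, Real.sq_sqrt hLK0.le]
        field_simp
        ring
  have hv : ‖v‖ / γ ≤ ‖x‖ + ‖x + γ⁻¹ • v‖ := by
    have h := norm_sub_le (x + γ⁻¹ • v) x
    rw [add_sub_cancel_left, norm_smul, Real.norm_of_nonneg (by positivity)] at h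
    rw [div_eq_inv_mul]
    linarith
  have hw : ‖(1 - 2 * τ) • x + γ⁻¹ • v‖ ≤ ‖x + γ⁻¹ • v‖ + 2 * τ * ‖x‖ := by
    have h := norm_sub_le (x + γ⁻¹ • v) ((2 * τ) • x)
    rw [norm_smul, Real.norm_of_nonneg (by positivity)] at h
    rwa [show x + γ⁻¹ • v - (2 * τ) • x = (1 - 2 * τ) • x + γ⁻¹ • v by module] at h
  have hbound : (inner ℝ (K x) x : ℝ) / γ ^ 2 + (1 / 2) * ‖v‖ ^ 2 / γ ^ 2
        + (1 / 2) * ‖(1 - 2 * τ) • x + γ⁻¹ • v‖ ^ 2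
      ≤ L_K / γ ^ 2 * ‖x‖ ^ 2 + (1 / 2) * (‖x‖ + ‖x + γ⁻¹ • v‖) ^ 2
        + (1 / 2) * (‖x + γ⁻¹ • v‖ + 2 * τ * ‖x‖) ^ 2 := by
    rw [mul_div_assoc, ← div_pow, div_mul_eq_mul_div L_K]
    gcongr
    exact hKub x
  have hquad := sq_mul_quadratic_le_sq_add hm0 hm1 hmα hmΛ hτ0 hτ8 (norm_nonneg x)
    (norm_nonneg (x + γ⁻¹ • v))
  rw [hεm]
  refine (le_abs_self _).trans (abs_le_of_sq_le_sq ?_ (by positivity))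
  have hnonneg : 0 ≤ (inner ℝ (K x) x : ℝ) :=
    (by positivity : 0 ≤ κ * ‖x‖ ^ 2).trans (hKlb x)
  rw [mul_pow, Real.sq_sqrt (by positivity)]
  exact (mul_le_mul_of_nonneg_left hbound (sq_nonneg m)).trans hquad
end

section
/- For all x, v ∈ ℝ^d one has r_s(x, v) ≤ (1/E₀)·r_l(x, v), where E₀ = (1/2)·min{1, √κ/(√2·αγ)}. -/
/-- A planar quadratic form estimate behind the comparison of the two norms. -/
lemma sq_add_le_quadratic_form {s τ X P : ℝ} (hs : 0 ≤ s) (hτs : τ ≤ s ^ 2)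
    (hτ : τ ≤ 1 / 8) :
    (1 / 4) * (s * X + P) ^ 2
      ≤ P ^ 2 - (1 + 2 * τ) * (P * X) + (1 / 2 + 2 * τ ^ 2 + 2 * s ^ 2) * X ^ 2 := by
  have hdisc : 0 ≤ 1 / 2 + 2 * τ ^ 2 + 5 * s ^ 2 - 4 * τ - s - 2 * τ * s := by
    nlinarith [mul_nonneg hs (sub_nonneg.2 hτ), sq_nonneg τ, sq_nonneg (s - 5 / 8)]
  nlinarith [mul_nonneg hdisc (sq_nonneg X),
    sq_nonneg (P - (2 / 3) * (1 + 2 * τ + s / 2) * X)]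

/-- The weighted sum of `‖x‖` and `‖x + w‖` is controlled by a twisted quadratic norm. -/
lemma half_mul_norm_add_norm_sq_le {E : Type*} [NormedAddCommGroup E] [InnerProductSpace ℝ E]
    {s τ : ℝ} (hs : 0 ≤ s) (hτ0 : 0 ≤ τ) (hτs : τ ≤ s ^ 2) (hτ : τ ≤ 1 / 8) (x w : E) :
    ((1 / 2) * (s * ‖x‖ + ‖x + w‖)) ^ 2
      ≤ 2 * s ^ 2 * ‖x‖ ^ 2 + (1 / 2) * ‖w‖ ^ 2 + (1 / 2) * ‖(1 - 2 * τ) • x + w‖ ^ 2 := by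
  obtain ⟨p, rfl⟩ : ∃ p, w = p - x := ⟨w + x, by simp⟩
  have hsum : x + (p - x) = p := by abel
  have htwist : (1 - 2 * τ) • x + (p - x) = p - (2 * τ) • x := by module
  rw [hsum, htwist, norm_sub_sq_real, norm_sub_sq_real, inner_smul_right, norm_smul,
    Real.norm_of_nonneg (by linarith)]
  have hinner := mul_le_mul_of_nonneg_left (real_inner_le_norm p x)
    (by linarith : 0 ≤ 1 + 2 * τ)
  linarith [sq_add_le_quadratic_form (X := ‖x‖) (P := ‖p‖) hs hτs hτ]

/-- `r_s(x,v) ≤ (1/E₀)·r_l(x,v)` with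
`E₀ = (1/2)·min{1, √κ/(√2·αγ)}`. -/
theorem rs_le_inv_E0_rl
    (d : ℕ) (hd : 1 ≤ d) (γ κ L_K L_g τ α E₀ : ℝ)
    (hγ : 0 < γ) (hκ : 0 < κ) (hLK : κ ≤ L_K) (hLg : 0 ≤ L_g)
    (hLgsmall : L_g < γ * Real.sqrt (κ / 2))
    (hτ : τ = min (1 / 8) (κ / (2 * γ ^ 2) - L_g ^ 2 / γ ^ 4))
    (hα : α = 2 * (L_K + L_g) / γ ^ 2)
    (hE₀ : E₀ = (1 / 2) * min 1 (Real.sqrt κ / (Real.sqrt 2 * α * γ)))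
    (K : EuclideanSpace ℝ (Fin d) →ₗ[ℝ] EuclideanSpace ℝ (Fin d))
    (hKsymm : ∀ x y : EuclideanSpace ℝ (Fin d), (inner ℝ (K x) y : ℝ) = inner ℝ x (K y))
    (hKlb : ∀ x : EuclideanSpace ℝ (Fin d), κ * ‖x‖ ^ 2 ≤ (inner ℝ (K x) x : ℝ))
    (hKub : ∀ x : EuclideanSpace ℝ (Fin d), (inner ℝ (K x) x : ℝ) ≤ L_K * ‖x‖ ^ 2)
    (x v : EuclideanSpace ℝ (Fin d)) :
    α * ‖x‖ + ‖x + γ⁻¹ • v‖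
      ≤ (1 / E₀) * Real.sqrt ((inner ℝ (K x) x : ℝ) / γ ^ 2 + (1 / 2) * ‖v‖ ^ 2 / γ ^ 2
        + (1 / 2) * ‖(1 - 2 * τ) • x + γ⁻¹ • v‖ ^ 2) := by
  have hs2 : (√κ / (√2 * γ)) ^ 2 = κ / (2 * γ ^ 2) := by
    rw [div_pow, mul_pow, Real.sq_sqrt hκ.le, Real.sq_sqrt zero_le_two]
  set s : ℝ := √κ / (√2 * γ) with hs_def
  have hs : 0 < s := by positivity
  have hα_pos : 0 < α := by
    have : 0 < L_K + L_g := by linarith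
    rw [hα]; positivity
  have hratio : √κ / (√2 * α * γ) = s / α := by
    rw [hs_def]; field_simp
  rw [hratio] at hE₀
  have hE₀_pos : 0 < E₀ := by rw [hE₀]; positivity
  have hE₀_half : E₀ ≤ 1 / 2 := by linarith [min_le_left 1 (s / α)]
  have hE₀α : E₀ * α ≤ s / 2 := by
    have : E₀ ≤ (1 / 2) * (s / α) := by linarith [min_le_right 1 (s / α)]
    calc E₀ * α ≤ (1 / 2) * (s / α) * α := by gcongr
      _ = s / 2 := by field_simp
  have hτ_le : τ ≤ 1 / 8 := hτ ▸ min_le_left _ _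
  have hτs : τ ≤ s ^ 2 := by
    have : 0 ≤ L_g ^ 2 / γ ^ 4 := by positivity
    have := min_le_right (1 / 8) (κ / (2 * γ ^ 2) - L_g ^ 2 / γ ^ 4)
    rw [hs2]; linarith
  have hτ0 : 0 ≤ τ := by
    rw [hτ]
    refine le_min (by norm_num) (sub_nonneg.2 ?_)
    have hsq : L_g ^ 2 ≤ γ ^ 2 * (κ / 2) := by
      have := pow_le_pow_left₀ hLg hLgsmall.le 2
      rwa [mul_pow, Real.sq_sqrt (by positivity)] at this
    calc L_g ^ 2 / γ ^ 4 ≤ γ ^ 2 * (κ / 2) / γ ^ 4 := by gcongr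
      _ = κ / (2 * γ ^ 2) := by field_simp
  rw [one_div_mul_eq_div, le_div_iff₀ hE₀_pos]
  apply Real.le_sqrt_of_sq_le
  have hscale : (α * ‖x‖ + ‖x + γ⁻¹ • v‖) * E₀ ≤ (1 / 2) * (s * ‖x‖ + ‖x + γ⁻¹ • v‖) := by
    linarith [mul_le_mul_of_nonneg_right hE₀α (norm_nonneg x),
      mul_le_mul_of_nonneg_right hE₀_half (norm_nonneg (x + γ⁻¹ • v))]
  have hK : 2 * s ^ 2 * ‖x‖ ^ 2 ≤ (inner ℝ (K x) x : ℝ) / γ ^ 2 := by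
    calc 2 * s ^ 2 * ‖x‖ ^ 2 = κ * ‖x‖ ^ 2 / γ ^ 2 := by rw [hs2]; field_simp
      _ ≤ _ := by gcongr; exact hKlb x
  have hv : (1 / 2) * ‖γ⁻¹ • v‖ ^ 2 = (1 / 2) * ‖v‖ ^ 2 / γ ^ 2 := by
    rw [norm_smul, mul_pow, Real.norm_eq_abs, sq_abs]; field_simp
  calc ((α * ‖x‖ + ‖x + γ⁻¹ • v‖) * E₀) ^ 2
      ≤ ((1 / 2) * (s * ‖x‖ + ‖x + γ⁻¹ • v‖)) ^ 2 := by gcongr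
    _ ≤ _ := half_mul_norm_add_norm_sq_le hs.le hτ0 hτs hτ_le x (γ⁻¹ • v)
    _ ≤ _ := by rw [hv]; gcongr
end

section
/- Let c > 0 and let f : [0, ∞) → [0, ∞) be a nondecreasing function with f(u) ≥ c·u for all u ≥ 0, and let D ≥ 0. Define Δ(x,v) := r_s(x,v) − ε₀·r_l(x,v) and ρ(x,v) := f( min(Δ(x,v), D) + ε₀·r_l(x,v) ). Then for all x, v ∈ ℝ^d, ρ(x, v) ≥ c·ε₀·γ^{-1}·min{√κ, √2/2}·( |x|² + |v|² )^{1/2}. -/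
/-- The value `min (r - s) D + s` lies above any lower bound of `s` when `s ≤ r` and `0 ≤ D`. -/
lemma le_min_sub_add {p r s D : ℝ} (hps : p ≤ s) (hsr : s ≤ r) (hD : 0 ≤ D) :
    p ≤ min (r - s) D + s := by
  have : 0 ≤ min (r - s) D := le_min (by linarith) hD
  linarith

/-- The twisted Euclidean norm dominates the standard one. -/
lemma inv_mul_min_mul_sqrt_le_sqrt {E : Type*} [SeminormedAddCommGroup E] {γ κ q w : ℝ}
    (hγ : 0 < γ) (hκ : 0 < κ) {x v : E}
    (hq : κ * ‖x‖ ^ 2 ≤ q) (hw : 0 ≤ w) :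
    γ⁻¹ * min (Real.sqrt κ) (Real.sqrt 2 / 2) * Real.sqrt (‖x‖ ^ 2 + ‖v‖ ^ 2)
      ≤ Real.sqrt (q / γ ^ 2 + (1 / 2) * ‖v‖ ^ 2 / γ ^ 2 + w) := by
  set m := min (Real.sqrt κ) (Real.sqrt 2 / 2)
  have hm0 : 0 ≤ m := by positivity
  have hm1 : m ^ 2 ≤ κ := by
    have := pow_le_pow_left₀ hm0 (min_le_left (Real.sqrt κ) (Real.sqrt 2 / 2)) 2
    rwa [Real.sq_sqrt hκ.le] at this
  have hm2 : m ^ 2 ≤ 1 / 2 := by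
    have := pow_le_pow_left₀ hm0 (min_le_right (Real.sqrt κ) (Real.sqrt 2 / 2)) 2
    rw [div_pow, Real.sq_sqrt (by norm_num)] at this
    linarith
  apply Real.le_sqrt_of_sq_le
  rw [mul_pow, mul_pow, Real.sq_sqrt (by positivity), inv_pow]
  have hsum : m ^ 2 * (‖x‖ ^ 2 + ‖v‖ ^ 2) ≤ q + (1 / 2) * ‖v‖ ^ 2 := by
    nlinarith [mul_le_mul_of_nonneg_right hm1 (sq_nonneg ‖x‖),
      mul_le_mul_of_nonneg_right hm2 (sq_nonneg ‖v‖)]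
  calc (γ ^ 2)⁻¹ * m ^ 2 * (‖x‖ ^ 2 + ‖v‖ ^ 2)
      = (γ ^ 2)⁻¹ * (m ^ 2 * (‖x‖ ^ 2 + ‖v‖ ^ 2)) := by ring
    _ ≤ (γ ^ 2)⁻¹ * (q + (1 / 2) * ‖v‖ ^ 2) := by gcongr
    _ = q / γ ^ 2 + (1 / 2) * ‖v‖ ^ 2 / γ ^ 2 := by ring
    _ ≤ _ := by linarith

/-- A small multiple of the twisted Euclidean norm is dominated by `α ‖x‖ + ‖x + γ⁻¹ v‖`. -/
lemma mul_sqrt_le_mul_norm_add_norm {E : Type*} [SeminormedAddCommGroup E] [NormedSpace ℝ E]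
    {γ L τ α ε q : ℝ} (hγ : 0 < γ) (hL : 0 < L)
    (hτ0 : 0 ≤ τ) (hτ1 : τ ≤ 1 / 8) (hα : 0 ≤ α) (hε0 : 0 ≤ ε) (hε1 : ε ≤ 1) (hεα : ε ≤ α)
    (hεL : ε ≤ 2 * α * γ / (3 * Real.sqrt L)) {x v : E} (hq : q ≤ L * ‖x‖ ^ 2) :
    ε * Real.sqrt (q / γ ^ 2 + (1 / 2) * ‖v‖ ^ 2 / γ ^ 2
        + (1 / 2) * ‖(1 - 2 * τ) • x + γ⁻¹ • v‖ ^ 2)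
      ≤ α * ‖x‖ + ‖x + γ⁻¹ • v‖ := by
  have hv : ‖v‖ / γ ≤ ‖x‖ + ‖x + γ⁻¹ • v‖ := by
    have h := norm_sub_le (x + γ⁻¹ • v) x
    rw [add_sub_cancel_left, norm_smul, Real.norm_of_nonneg (inv_nonneg.2 hγ.le)] at h
    rw [div_eq_inv_mul]
    linarith
  have hw : ‖(1 - 2 * τ) • x + γ⁻¹ • v‖ ≤ ‖x‖ / 4 + ‖x + γ⁻¹ • v‖ := by
    have h := norm_sub_le (x + γ⁻¹ • v) ((2 * τ) • x)
    rw [norm_smul, Real.norm_of_nonneg (by positivity)] at h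
    have he : (1 - 2 * τ) • x + γ⁻¹ • v = x + γ⁻¹ • v - (2 * τ) • x := by module
    rw [he]
    nlinarith [norm_nonneg x]
  have hεL2 : ε ^ 2 * (L / γ ^ 2) ≤ 4 / 9 * α ^ 2 := by
    have h := pow_le_pow_left₀ hε0 hεL 2
    rw [div_pow, mul_pow 3, Real.sq_sqrt hL.le, le_div_iff₀ (by positivity)] at h
    rw [← mul_div_assoc, div_le_iff₀ (by positivity)]
    linarith
  set a := ‖x‖
  set b := ‖x + γ⁻¹ • v‖
  have ha : 0 ≤ a := norm_nonneg _
  have hb : 0 ≤ b := norm_nonneg _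
  have hbound : q / γ ^ 2 + (1 / 2) * ‖v‖ ^ 2 / γ ^ 2
        + (1 / 2) * ‖(1 - 2 * τ) • x + γ⁻¹ • v‖ ^ 2
      ≤ L / γ ^ 2 * a ^ 2 + (1 / 2) * (a + b) ^ 2 + (1 / 2) * (a / 4 + b) ^ 2 := by
    have h1 : q / γ ^ 2 ≤ L / γ ^ 2 * a ^ 2 := by
      rw [div_mul_eq_mul_div]
      gcongr
    have h2 := pow_le_pow_left₀ (by positivity) hv 2
    have h3 := pow_le_pow_left₀ (norm_nonneg _) hw 2
    have h4 : (1 / 2) * ‖v‖ ^ 2 / γ ^ 2 = (1 / 2) * (‖v‖ / γ) ^ 2 := by ring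
    rw [h4]
    linarith
  have hε2α : ε ^ 2 ≤ α ^ 2 := pow_le_pow_left₀ hε0 hεα 2
  have hε21 : ε ^ 2 ≤ 1 := pow_le_one₀ hε0 hε1
  have hε2 : ε ^ 2 ≤ α := by nlinarith
  calc ε * Real.sqrt _
      ≤ ε * Real.sqrt (L / γ ^ 2 * a ^ 2 + (1 / 2) * (a + b) ^ 2 + (1 / 2) * (a / 4 + b) ^ 2) := by
        gcongr
    _ ≤ α * a + b := by
        refine abs_le_of_sq_le_sq' ?_ (by positivity) |>.2
        rw [mul_pow, Real.sq_sqrt (by positivity)]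
        nlinarith [mul_le_mul_of_nonneg_right hεL2 (sq_nonneg a),
          mul_le_mul_of_nonneg_right hε2α (sq_nonneg a),
          mul_le_mul_of_nonneg_right hε21 (sq_nonneg b),
          mul_le_mul_of_nonneg_right hε2 (mul_nonneg ha hb),
          mul_nonneg hα (mul_nonneg ha hb), mul_nonneg (sq_nonneg α) (sq_nonneg a)]

/-- for a nondecreasing `f : [0,∞) → [0,∞)` with `f(u) ≥ c·u` and
`D ≥ 0`, the function `ρ(x,v) = f(min(Δ(x,v), D) + ε₀·r_l(x,v))` with
`Δ = r_s − ε₀·r_l` satisfies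
`ρ(x,v) ≥ c·ε₀·γ⁻¹·min{√κ, √2/2}·√(‖x‖² + ‖v‖²)`. -/
theorem rho_lower_bound
    (d : ℕ) (hd : 1 ≤ d) (γ κ L_K L_g τ α ε₀ : ℝ)
    (hγ : 0 < γ) (hκ : 0 < κ) (hLK : κ ≤ L_K) (hLg : 0 ≤ L_g)
    (hLgsmall : L_g < γ * Real.sqrt (κ / 2))
    (hτ : τ = min (1 / 8) (κ / (2 * γ ^ 2) - L_g ^ 2 / γ ^ 4))
    (hα : α = 2 * (L_K + L_g) / γ ^ 2)
    (hε₀ : ε₀ = (1 / 2) * min 1 (min (2 * α * γ / (3 * Real.sqrt L_K)) α))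
    (K : EuclideanSpace ℝ (Fin d) →ₗ[ℝ] EuclideanSpace ℝ (Fin d))
    (hKsymm : ∀ x y : EuclideanSpace ℝ (Fin d), (inner ℝ (K x) y : ℝ) = inner ℝ x (K y))
    (hKlb : ∀ x : EuclideanSpace ℝ (Fin d), κ * ‖x‖ ^ 2 ≤ (inner ℝ (K x) x : ℝ))
    (hKub : ∀ x : EuclideanSpace ℝ (Fin d), (inner ℝ (K x) x : ℝ) ≤ L_K * ‖x‖ ^ 2)
    (c : ℝ) (hc : 0 < c) (D : ℝ) (hD : 0 ≤ D)
    (f : ℝ → ℝ)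
    (hf_nonneg : ∀ u, 0 ≤ u → 0 ≤ f u)
    (hf_mono : MonotoneOn f (Set.Ici 0))
    (hf_lb : ∀ u, 0 ≤ u → c * u ≤ f u)
    (x v : EuclideanSpace ℝ (Fin d)) :
    c * ε₀ * γ⁻¹ * min (Real.sqrt κ) (Real.sqrt 2 / 2) * Real.sqrt (‖x‖ ^ 2 + ‖v‖ ^ 2)
      ≤ f (min ((α * ‖x‖ + ‖x + γ⁻¹ • v‖)
            - ε₀ * Real.sqrt ((inner ℝ (K x) x : ℝ) / γ ^ 2 + (1 / 2) * ‖v‖ ^ 2 / γ ^ 2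
                + (1 / 2) * ‖(1 - 2 * τ) • x + γ⁻¹ • v‖ ^ 2)) D
          + ε₀ * Real.sqrt ((inner ℝ (K x) x : ℝ) / γ ^ 2 + (1 / 2) * ‖v‖ ^ 2 / γ ^ 2
                + (1 / 2) * ‖(1 - 2 * τ) • x + γ⁻¹ • v‖ ^ 2)) := by
  have hτ0 : 0 ≤ τ := by
    have hsq : L_g ^ 2 ≤ γ ^ 2 * (κ / 2) := by
      have h := pow_le_pow_left₀ hLg hLgsmall.le 2
      rwa [mul_pow, Real.sq_sqrt (by positivity)] at h
    have hdiff : L_g ^ 2 / γ ^ 4 ≤ κ / (2 * γ ^ 2) := by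
      rw [div_le_div_iff₀ (by positivity) (by positivity)]
      nlinarith [mul_le_mul_of_nonneg_right hsq (sq_nonneg γ)]
    rw [hτ]
    exact le_min (by norm_num) (by linarith)
  have hτ1 : τ ≤ 1 / 8 := hτ ▸ min_le_left _ _
  have hL : 0 < L_K := hκ.trans_le hLK
  have hα0 : 0 < α := by rw [hα]; positivity
  set M := min 1 (min (2 * α * γ / (3 * Real.sqrt L_K)) α)
  have hM0 : 0 < M := by
    have := Real.sqrt_pos.2 hL
    positivity
  have hε0 : 0 ≤ ε₀ := by linarith
  have hεM : ε₀ ≤ M := by linarith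
  have hlower := inv_mul_min_mul_sqrt_le_sqrt (v := v) hγ hκ (hKlb x)
    (w := (1 / 2) * ‖(1 - 2 * τ) • x + γ⁻¹ • v‖ ^ 2) (by positivity)
  have hupper := mul_sqrt_le_mul_norm_add_norm (v := v) hγ hL hτ0 hτ1 hα0.le hε0
    (hεM.trans (min_le_left _ _))
    (hεM.trans ((min_le_right _ _).trans (min_le_right _ _)))
    (hεM.trans ((min_le_right _ _).trans (min_le_left _ _))) (hKub x)
  have harg := le_min_sub_add (mul_le_mul_of_nonneg_left hlower hε0) hupper hD
  refine le_trans ?_ (hf_lb _ (le_trans (by positivity) harg))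
  refine le_trans (le_of_eq ?_) (mul_le_mul_of_nonneg_left harg hc.le)
  ring
end

section
/- For all x ∈ ℝ^d one has the quadratic form inequality −(1 − 2τ)·γ^{-1}·⟨Kx, x⟩ + γ^{-3}·L_g²·|x|² ≤ −2τγ·( γ^{-2}⟨Kx, x⟩ + (1/2)(1 − 2τ)²|x|² ). -/
/-- the quadratic form inequality
`−(1 − 2τ)·γ⁻¹·⟪Kx, x⟫ + γ⁻³·L_g²·‖x‖² ≤ −2τγ·(γ⁻²⟪Kx, x⟫ + (1/2)(1 − 2τ)²‖x‖²)`. -/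
theorem quadratic_form_inequality
    (d : ℕ) (hd : 1 ≤ d) (γ κ L_K L_g τ : ℝ)
    (hγ : 0 < γ) (hκ : 0 < κ) (hLK : κ ≤ L_K) (hLg : 0 ≤ L_g)
    (hLgsmall : L_g < γ * Real.sqrt (κ / 2))
    (hτ : τ = min (1 / 8) (κ / (2 * γ ^ 2) - L_g ^ 2 / γ ^ 4))
    (K : EuclideanSpace ℝ (Fin d) →ₗ[ℝ] EuclideanSpace ℝ (Fin d))
    (hKsymm : ∀ x y : EuclideanSpace ℝ (Fin d), (inner ℝ (K x) y : ℝ) = inner ℝ x (K y))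
    (hKlb : ∀ x : EuclideanSpace ℝ (Fin d), κ * ‖x‖ ^ 2 ≤ (inner ℝ (K x) x : ℝ))
    (hKub : ∀ x : EuclideanSpace ℝ (Fin d), (inner ℝ (K x) x : ℝ) ≤ L_K * ‖x‖ ^ 2)
    (x : EuclideanSpace ℝ (Fin d)) :
    -(1 - 2 * τ) * γ⁻¹ * (inner ℝ (K x) x : ℝ) + γ⁻¹ ^ 3 * L_g ^ 2 * ‖x‖ ^ 2
      ≤ -(2 * τ * γ) * (γ⁻¹ ^ 2 * (inner ℝ (K x) x : ℝ)
          + (1 / 2) * (1 - 2 * τ) ^ 2 * ‖x‖ ^ 2) := by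
  have hLg_sq : L_g ^ 2 < γ ^ 2 * (κ / 2) := by
    calc L_g ^ 2 < (γ * Real.sqrt (κ / 2)) ^ 2 := by gcongr
      _ = γ ^ 2 * (κ / 2) := by rw [mul_pow, Real.sq_sqrt (by positivity)]
  have hτ_le : τ ≤ 1 / 8 := hτ ▸ min_le_left _ _
  have hτ_le' : τ ≤ κ / (2 * γ ^ 2) - L_g ^ 2 / γ ^ 4 := hτ ▸ min_le_right _ _
  have hτ_pos : 0 < τ := by
    rw [hτ, lt_min_iff]
    refine ⟨by norm_num, ?_⟩
    have h : κ / (2 * γ ^ 2) - L_g ^ 2 / γ ^ 4 = (γ ^ 2 * (κ / 2) - L_g ^ 2) / γ ^ 4 := by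
      field_simp
    rw [h]
    exact div_pos (sub_pos.mpr hLg_sq) (by positivity)
  have hcoef : L_g ^ 2 / γ ^ 4 + τ * (1 - 2 * τ) ^ 2 ≤ (1 - 4 * τ) * (κ / γ ^ 2) := by
    have h₁ : τ * (1 - 2 * τ) ^ 2 ≤ τ :=
      mul_le_of_le_one_right hτ_pos.le (by nlinarith)
    have h₂ : κ / (2 * γ ^ 2) = 1 / 2 * (κ / γ ^ 2) := by field_simp
    have h₃ : 1 / 2 * (κ / γ ^ 2) ≤ (1 - 4 * τ) * (κ / γ ^ 2) := by
      gcongr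
      linarith
    linarith
  have hmain : (L_g ^ 2 / γ ^ 4 + τ * (1 - 2 * τ) ^ 2) * ‖x‖ ^ 2
      ≤ (1 - 4 * τ) * (inner ℝ (K x) x / γ ^ 2) := by
    calc _ ≤ (1 - 4 * τ) * (κ / γ ^ 2) * ‖x‖ ^ 2 := by gcongr
      _ = (1 - 4 * τ) * (κ * ‖x‖ ^ 2 / γ ^ 2) := by ring
      _ ≤ _ := by
        have : 0 ≤ 1 - 4 * τ := by linarith
        gcongr
        exact hKlb x
  rw [← sub_nonneg] at hmain ⊢
  refine (mul_nonneg hγ.le hmain).trans_eq ?_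
  field_simp
  ring
end
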